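/- arXiv:2203.14598 — 2 statements merged into one kernel-verified Lean document; each statement's English description precedes it below -/
import Mathlib

section
/- Let Γ = ⟨S_Γ⟩ and Λ = ⟨S_Λ⟩ be finitely generated groups whose Cayley graphs (Γ,S_Γ) and (Λ,S_Λ) are isometric. Let m_Λ be the Haar probability measure on Iso(Γ,Λ)/Λ and m_Γ the Haar probability measure on Iso(Λ,Γ)/Γ. Then the p.m.p. actions Γ ↷ (Iso(Γ,Λ)/Λ, m_Λ) and Λ ↷ (Iso(Λ,Γ)/Γ, m_Γ) are isometric orbit equivalent. -/
open MeasureTheory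

namespace IOE

/-- Word length of a group element with respect to a set `S`, valued in `ℕ∞`
(`⊤` if the element is not a product of elements of `S`). -/
noncomputable def wlen {G : Type*} [Group G] (S : Set G) (g : G) : ℕ∞ :=
  sInf {n : ℕ∞ | ∃ l : List G, (∀ s ∈ l, s ∈ S) ∧ l.prod = g ∧ (l.length : ℕ∞) = n}

/-- A generating system: a symmetric generating set not containing the identity. -/
structure IsGenSystem {G : Type*} [Group G] (S : Set G) : Prop where
  inv_mem : ∀ s ∈ S, s⁻¹ ∈ S
  one_not_mem : (1 : G) ∉ S
  closure_eq_top : Subgroup.closure S = ⊤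

/-- A finite generating system. -/
structure IsFinGenSystem {G : Type*} [Group G] (S : Set G) extends IsGenSystem S : Prop where
  finite : S.Finite

/-- The extended graph metric on `X` associated with an action `act` of `G` on `X`
and a set `S ⊆ G`: the length of a shortest `S`-path from `x` to `y`. -/
noncomputable def gdist {G X : Type*} (act : G → X → X) (S : Set G) (x y : X) : ℕ∞ :=
  sInf {n : ℕ∞ | ∃ l : List G, (∀ s ∈ l, s ∈ S) ∧ l.foldr act x = y ∧ (l.length : ℕ∞) = n}

/-- A set is saturated if it is a union of connected components of the graphing. -/
def Saturated {G X : Type*} (act : G → X → X) (S : Set G) (A : Set X) : Prop :=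
  ∀ x ∈ A, ∀ y : X, gdist act S x y ≠ ⊤ → y ∈ A

/-- `act` is a probability-measure-preserving action of `G` on `(X, μ)`. -/
structure IsPmpAction {G X : Type*} [Group G] [MeasurableSpace X]
    (act : G → X → X) (μ : Measure X) : Prop where
  one_act : ∀ x, act 1 x = x
  mul_act : ∀ g h x, act (g * h) x = act g (act h x)
  measurePreserving : ∀ g, MeasurePreserving (act g) μ μ

/-- An action is essentially free if almost every point has trivial stabilizer. -/
def EssentiallyFree {G X : Type*} [Group G] [MeasurableSpace X]
    (act : G → X → X) (μ : Measure X) : Prop :=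
  ∀ᵐ x ∂μ, ∀ g : G, act g x = x → g = 1

/-- Two actions are isometric orbit equivalent: there is a measure-preserving
bimeasurable bijection which is an isometry between the graphings, on a saturated
conull set. -/
def IsomOrbitEquiv {G H X Y : Type*} [MeasurableSpace X] [MeasurableSpace Y]
    (actA : G → X → X) (SG : Set G) (μ : Measure X)
    (actB : H → Y → Y) (SH : Set H) (ν : Measure Y) : Prop :=
  ∃ Φ : X ≃ Y, Measurable Φ ∧ Measurable Φ.symm ∧ MeasurePreserving Φ μ ν ∧
    ∃ X₀ : Set X, μ X₀ᶜ = 0 ∧ Saturated actA SG X₀ ∧ Saturated actB SH (Φ '' X₀) ∧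
      ∀ x ∈ X₀, ∀ x' ∈ X₀, gdist actB SH (Φ x) (Φ x') = gdist actA SG x x'

/-- A measurable cocycle `σ : G × X → H` for the action `act` of `G` on `(X, μ)`. -/
def IsCocycle {G H X : Type*} [Group G] [Group H] [MeasurableSpace X]
    (act : G → X → X) (μ : Measure X) (σ : G → X → H) : Prop :=
  (∀ (g : G) (h : H), MeasurableSet {x | σ g x = h}) ∧
  ∀ g h : G, ∀ᵐ x ∂μ, σ (g * h) x = σ g (act h x) * σ h x

/-- A cocycle is length-preserving if it preserves the word lengths almost surely. -/
def LengthPreservingCocycle {G H X : Type*} [Group G] [Group H] [MeasurableSpace X]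
    (SG : Set G) (SH : Set H) (μ : Measure X) (σ : G → X → H) : Prop :=
  ∀ g : G, ∀ᵐ x ∂μ, wlen SH (σ g x) = wlen SG g

end IOE
namespace IOE

variable {Γ Λ Ξ : Type*} [Group Γ] [Group Λ] [Group Ξ]

/-- A bijective isometry between the Cayley graphs `(Γ, S)` and `(Λ, T)`. -/
structure CayleyIso (S : Set Γ) (T : Set Λ) where
  toEquiv : Γ ≃ Λ
  isom : ∀ a b : Γ, wlen T ((toEquiv a)⁻¹ * toEquiv b) = wlen S (a⁻¹ * b)

namespace CayleyIso

variable {S : Set Γ} {T : Set Λ} {U : Set Ξ}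

@[ext] theorem ext {f g : CayleyIso S T} (h : ∀ x, f.toEquiv x = g.toEquiv x) : f = g := by
  cases f; cases g
  simp only [mk.injEq]
  exact Equiv.ext h

/-- Composition of Cayley isometries (`comp g f` applies `f` first). -/
def comp (g : CayleyIso T U) (f : CayleyIso S T) : CayleyIso S U where
  toEquiv := f.toEquiv.trans g.toEquiv
  isom := fun a b => by
    simpa [Equiv.trans_apply] using (g.isom (f.toEquiv a) (f.toEquiv b)).trans (f.isom a b)

/-- The inverse of a Cayley isometry. -/
def inv (f : CayleyIso S T) : CayleyIso T S where
  toEquiv := f.toEquiv.symm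
  isom := fun a b => by
    simpa using (f.isom (f.toEquiv.symm a) (f.toEquiv.symm b)).symm

/-- The identity Cayley isometry. -/
def refl (S : Set Γ) : CayleyIso S S := ⟨Equiv.refl Γ, fun _ _ => rfl⟩

/-- The group `Iso(Γ)` of bijective isometries of the Cayley graph `(Γ, S)`,
under composition. -/
instance : Group (CayleyIso S S) where
  mul f g := comp f g
  one := refl S
  inv := inv
  mul_assoc f g h := ext fun x => rfl
  one_mul f := ext fun x => rfl
  mul_one f := ext fun x => rfl
  inv_mul_cancel f := ext fun x => f.toEquiv.symm_apply_apply x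

@[simp] theorem mul_apply (f g : CayleyIso S S) (x : Γ) :
    (f * g).toEquiv x = f.toEquiv (g.toEquiv x) := rfl

@[simp] theorem one_apply (x : Γ) : (1 : CayleyIso S S).toEquiv x = x := rfl

@[simp] theorem inv_apply (f : CayleyIso S S) (x : Γ) :
    (f⁻¹).toEquiv x = f.toEquiv.symm x := rfl

/-- Left multiplication by a group element, as a Cayley isometry. -/
def leftMult (S : Set Γ) (γ : Γ) : CayleyIso S S where
  toEquiv := Equiv.mulLeft γ
  isom := fun a b => by
    simp only [Equiv.coe_mulLeft]
    congr 1
    group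

@[simp] theorem leftMult_apply (γ x : Γ) : (leftMult S γ).toEquiv x = γ * x := rfl

/-- Post-composition by left multiplication. -/
def lsmul (lam : Λ) (f : CayleyIso S T) : CayleyIso S T where
  toEquiv := f.toEquiv.trans (Equiv.mulLeft lam)
  isom := fun a b => by
    simp only [Equiv.trans_apply, Equiv.coe_mulLeft]
    rw [show (lam * f.toEquiv a)⁻¹ * (lam * f.toEquiv b)
        = (f.toEquiv a)⁻¹ * f.toEquiv b by group, f.isom]

@[simp] theorem lsmul_apply (lam : Λ) (f : CayleyIso S T) (x : Γ) :
    (lsmul lam f).toEquiv x = lam * f.toEquiv x := rfl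

/-- The action of `Λ` on `Iso(Γ,Λ)` by post-composition. -/
instance : MulAction Λ (CayleyIso S T) where
  smul := lsmul
  one_smul f := ext fun x => one_mul _
  mul_smul a b f := ext fun x => mul_assoc a b _

@[simp] theorem smul_apply (lam : Λ) (f : CayleyIso S T) (x : Γ) :
    (lam • f).toEquiv x = lam * f.toEquiv x := rfl

/-- The σ-algebra of pointwise convergence on `Iso(Γ,Λ)`. -/
instance : MeasurableSpace (CayleyIso S T) :=
  MeasurableSpace.comap (fun f (γ : Γ) => f.toEquiv γ)
    (@MeasurableSpace.pi Γ (fun _ => Λ) (fun _ => ⊤))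

/-- The topology of pointwise convergence on `Iso(Γ,Λ)`. -/
instance : TopologicalSpace (CayleyIso S T) :=
  TopologicalSpace.induced (fun f (γ : Γ) => f.toEquiv γ)
    (@Pi.topologicalSpace Γ (fun _ => Λ) (fun _ => ⊥))

end CayleyIso

/-- `Iso₁(Γ,Λ)`: the bijective isometries between the Cayley graphs sending `1` to `1`. -/
def Iso1 {Γ Λ : Type*} [Group Γ] [Group Λ] (S : Set Γ) (T : Set Λ) : Type _ :=
  {f : CayleyIso S T // f.toEquiv 1 = 1}

namespace Iso1

variable {S : Set Γ} {T : Set Λ}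

instance : MeasurableSpace (Iso1 S T) := by unfold Iso1; infer_instance
instance : TopologicalSpace (Iso1 S T) := by unfold Iso1; infer_instance

/-- The natural action of `Γ` on `Iso₁(Γ,Λ)`: `(γ · f)(δ) = f(γ⁻¹)⁻¹ f(γ⁻¹δ)`. -/
def natAct (γ : Γ) (f : Iso1 S T) : Iso1 S T :=
  ⟨CayleyIso.lsmul (f.1.toEquiv γ⁻¹)⁻¹ (CayleyIso.comp f.1 (CayleyIso.leftMult S γ⁻¹)), by
    show (f.1.toEquiv γ⁻¹)⁻¹ * f.1.toEquiv (γ⁻¹ * 1) = 1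
    rw [mul_one, inv_mul_cancel]⟩

@[simp] theorem natAct_apply (γ : Γ) (f : Iso1 S T) (δ : Γ) :
    (natAct γ f).1.toEquiv δ = (f.1.toEquiv γ⁻¹)⁻¹ * f.1.toEquiv (γ⁻¹ * δ) := rfl

/-- Pre-composition by an element of `Iso₁(Γ)`. -/
def pre1 (h : Iso1 S S) (f : Iso1 S T) : Iso1 S T :=
  ⟨CayleyIso.comp f.1 h.1, by show f.1.toEquiv (h.1.toEquiv 1) = 1; rw [h.2, f.2]⟩

/-- Post-composition by an element of `Iso₁(Λ)`. -/
def post1 (k : Iso1 T T) (f : Iso1 S T) : Iso1 S T :=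
  ⟨CayleyIso.comp k.1 f.1, by show k.1.toEquiv (f.1.toEquiv 1) = 1; rw [f.2, k.2]⟩

/-- The inverse map `Iso₁(Γ,Λ) → Iso₁(Λ,Γ)`. -/
def inv1 (f : Iso1 S T) : Iso1 T S :=
  ⟨f.1.inv, by
    show f.1.toEquiv.symm 1 = 1
    exact (Equiv.symm_apply_eq _).mpr f.2.symm⟩

/-- The inverse map, as a bijection `Iso₁(Γ,Λ) ≃ Iso₁(Λ,Γ)`. -/
def invEquiv1 : Iso1 S T ≃ Iso1 T S where
  toFun := inv1
  invFun := inv1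
  left_inv f := Subtype.ext (CayleyIso.ext fun x => by simp [inv1, CayleyIso.inv])
  right_inv f := Subtype.ext (CayleyIso.ext fun x => by simp [inv1, CayleyIso.inv])

end Iso1

end IOE
namespace IOE

variable {Γ Λ : Type*} [Group Γ] [Group Λ]

/-- The action of `Iso(Γ)` on `Iso(Γ,Λ)` by pre-composition by the inverse,
descended to the quotient `Iso(Γ,Λ)/Λ` of `Iso(Γ,Λ)` by the post-composition
action of `Λ`. -/
def preQ {S : Set Γ} {T : Set Λ} (g : CayleyIso S S) :
    Quotient (MulAction.orbitRel Λ (CayleyIso S T)) →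
      Quotient (MulAction.orbitRel Λ (CayleyIso S T)) :=
  Quotient.map (fun f => CayleyIso.comp f g⁻¹) (by
    intro a b hab
    obtain ⟨lam, rfl⟩ := hab
    exact ⟨lam, CayleyIso.ext fun x => rfl⟩)

end IOE

namespace IOE

section WordMetric

variable {G H X Y : Type*} [Group G] [Group H]

theorem foldr_act_eq_prod (act : G → X → X) (h1 : ∀ x, act 1 x = x)
    (hmul : ∀ g h x, act (g * h) x = act g (act h x)) (l : List G) (x : X) :
    l.foldr act x = act l.prod x := by
  induction l with
  | nil => simp [h1]
  | cons a l ih => simp [ih, hmul]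

theorem wlen_prod_le {S : Set G} {l : List G} (hl : ∀ s ∈ l, s ∈ S) :
    wlen S l.prod ≤ l.length :=
  sInf_le ⟨l, hl, rfl, rfl⟩

theorem gdist_le_wlen (act : G → X → X) (h1 : ∀ x, act 1 x = x)
    (hmul : ∀ g h x, act (g * h) x = act g (act h x)) (S : Set G) (g : G) (x : X) :
    gdist act S x (act g x) ≤ wlen S g := by
  refine le_sInf ?_
  rintro n ⟨l, hl, rfl, rfl⟩
  exact sInf_le ⟨l, hl, foldr_act_eq_prod act h1 hmul l x, rfl⟩

/-- A map which intertwines two actions up to a length-preserving change of group elements does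
not increase the graph distance. -/
theorem gdist_map_le {actA : G → X → X} {actB : H → Y → Y}
    (hA1 : ∀ x, actA 1 x = x) (hAmul : ∀ g h x, actA (g * h) x = actA g (actA h x))
    (hB1 : ∀ y, actB 1 y = y) (hBmul : ∀ g h y, actB (g * h) y = actB g (actB h y))
    {S : Set G} {T : Set H} {φ : X → Y}
    (hφ : ∀ g x, ∃ h, wlen T h = wlen S g ∧ φ (actA g x) = actB h (φ x)) (x x' : X) :
    gdist actB T (φ x) (φ x') ≤ gdist actA S x x' := by
  refine le_sInf ?_
  rintro n ⟨l, hl, rfl, rfl⟩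
  rw [foldr_act_eq_prod actA hA1 hAmul]
  obtain ⟨h, hlen, heq⟩ := hφ l.prod x
  rw [heq]
  exact (gdist_le_wlen actB hB1 hBmul T h _).trans (hlen.trans_le (wlen_prod_le hl))

theorem IsFinGenSystem.countable {S : Set G} (hS : IsFinGenSystem S) : Countable G := by
  have : Countable S := hS.finite.countable
  have hsurj : Function.Surjective (FreeGroup.lift ((↑) : S → G)) := by
    rw [← MonoidHom.range_eq_top, FreeGroup.range_lift_eq_closure, Subtype.range_coe]
    exact hS.closure_eq_top
  exact hsurj.countable

end WordMetric

namespace CayleyIso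

variable {Γ Λ Ξ : Type*} [Group Γ] [Group Λ] [Group Ξ]
  {S : Set Γ} {T : Set Λ} {U : Set Ξ}

@[simp] theorem comp_apply (g : CayleyIso T U) (f : CayleyIso S T) (x : Γ) :
    (comp g f).toEquiv x = g.toEquiv (f.toEquiv x) := rfl

@[simp] theorem inv_toEquiv (f : CayleyIso S T) : f.inv.toEquiv = f.toEquiv.symm := rfl

@[simp] theorem leftMult_toEquiv_symm_apply (γ x : Γ) :
    (leftMult S γ).toEquiv.symm x = γ⁻¹ * x := rfl

/-- The representative of the `Λ`-orbit of `f` which sends `1` to `1`. -/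
def normalize (f : CayleyIso S T) : CayleyIso S T := (f.toEquiv 1)⁻¹ • f

@[simp] theorem normalize_apply (f : CayleyIso S T) (x : Γ) :
    f.normalize.toEquiv x = (f.toEquiv 1)⁻¹ * f.toEquiv x := rfl

theorem normalize_smul (a : Λ) (f : CayleyIso S T) : (a • f).normalize = f.normalize :=
  ext fun x => by simp [mul_assoc]

theorem normalize_eq_self {f : CayleyIso S T} (hf : f.toEquiv 1 = 1) : f.normalize = f :=
  ext fun x => by simp [hf]

theorem inv_one_eq {f : CayleyIso S T} (hf : f.toEquiv 1 = 1) : f.inv.toEquiv 1 = 1 :=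
  f.toEquiv.symm_apply_eq.mpr hf.symm

theorem normalize_one (f : CayleyIso S T) : f.normalize.toEquiv 1 = 1 := by simp

theorem inv_inv_eq (f : CayleyIso S T) : f.inv.inv = f := rfl

theorem measurable_eval [MeasurableSpace Λ] (x : Γ) :
    Measurable fun f : CayleyIso S T => f.toEquiv x := by
  intro s _
  exact ⟨(fun h : Γ → Λ => h x) ⁻¹' s,
    @measurable_pi_apply Γ (fun _ => Λ) (fun _ => ⊤) x s trivial, rfl⟩

theorem measurable_of_fiber [Countable Λ] {Z : Type*} [MeasurableSpace Z]
    {F : Z → CayleyIso S T} (hF : ∀ x y, MeasurableSet {z | (F z).toEquiv x = y}) :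
    Measurable F := by
  refine measurable_iff_comap_le.mpr ?_
  rw [instMeasurableSpace, MeasurableSpace.comap_comp, ← measurable_iff_comap_le]
  let _ : MeasurableSpace Λ := ⊤
  exact measurable_pi_lambda _ fun x => measurable_to_countable' fun y => hF x y

theorem measurableSet_fiber (x : Γ) (y : Λ) :
    MeasurableSet {f : CayleyIso S T | f.toEquiv x = y} := by
  let _ : MeasurableSpace Λ := ⊤
  exact measurable_eval x (measurableSet_singleton y)

theorem measurable_inv [Countable Γ] : Measurable (inv : CayleyIso S T → CayleyIso T S) := by
  refine measurable_of_fiber fun x y => ?_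
  have : {f : CayleyIso S T | f.inv.toEquiv x = y} = {f | f.toEquiv y = x} := by
    ext f
    exact f.toEquiv.symm_apply_eq.trans eq_comm
  rw [this]
  exact measurableSet_fiber y x

theorem measurable_normalize [Countable Λ] :
    Measurable (normalize : CayleyIso S T → CayleyIso S T) := by
  let _ : MeasurableSpace Λ := ⊤
  refine measurable_of_fiber fun x y => ?_
  have : Measurable fun f : CayleyIso S T => (f.toEquiv 1)⁻¹ * f.toEquiv x :=
    (measurable_eval 1).inv.mul (measurable_eval x)
  exact this (measurableSet_singleton y)

theorem measurable_comp [Countable Λ] [Countable Ξ] {Z : Type*} [MeasurableSpace Z]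
    {G : Z → CayleyIso T U} {F : Z → CayleyIso S T} (hG : Measurable G) (hF : Measurable F) :
    Measurable fun z => comp (G z) (F z) := by
  refine measurable_of_fiber fun x u => ?_
  have : {z | (comp (G z) (F z)).toEquiv x = u} =
      ⋃ y : Λ, {z | (G z).toEquiv y = u} ∩ {z | (F z).toEquiv x = y} := by
    ext z
    simp
  rw [this]
  exact .iUnion fun y => (hG (measurableSet_fiber y u)).inter (hF (measurableSet_fiber x y))

end CayleyIso

open CayleyIso

/-- The quotient `Iso(Γ,Λ)/Λ` by the post-composition action of `Λ`. -/
abbrev IsoQuot {Γ Λ : Type*} [Group Γ] [Group Λ] (S : Set Γ) (T : Set Λ) : Type _ :=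
  Quotient (MulAction.orbitRel Λ (CayleyIso S T))

namespace IsoQuot

variable {Γ Λ : Type*} [Group Γ] [Group Λ] {S : Set Γ} {T : Set Λ}

/-- The class of an isometry in `Iso(Γ,Λ)/Λ`. -/
def mk (f : CayleyIso S T) : IsoQuot S T := Quotient.mk _ f

theorem ind {p : IsoQuot S T → Prop} (h : ∀ f, f.toEquiv 1 = 1 → p (mk f)) (x : IsoQuot S T) :
    p x := by
  induction x using Quotient.ind with
  | _ f =>
    have : mk f = mk f.normalize := Quotient.sound ⟨f.toEquiv 1, by
      ext x; simp⟩
    change p (mk f)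
    rw [this]
    exact h _ f.normalize_one

theorem measurable_mk : Measurable (mk : CayleyIso S T → IsoQuot S T) :=
  measurable_quotient_mk''

theorem mk_smul (a : Λ) (f : CayleyIso S T) : mk (a • f) = mk f := Quotient.sound ⟨a, rfl⟩

/-- The representative of a class which sends `1` to `1`. -/
def rep : IsoQuot S T → CayleyIso S T :=
  Quotient.lift normalize (by
    rintro _ f ⟨a, rfl⟩
    exact normalize_smul a f)

theorem rep_mk {f : CayleyIso S T} (hf : f.toEquiv 1 = 1) : rep (mk f) = f :=
  normalize_eq_self hf

theorem measurable_rep [Countable Λ] : Measurable (rep : IsoQuot S T → CayleyIso S T) :=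
  measurable_from_quotient.mpr measurable_normalize

theorem preQ_mk (g : CayleyIso S S) (f : CayleyIso S T) :
    preQ g (mk f) = mk (comp f g⁻¹) := rfl

/-- The bijection `Iso(Γ,Λ)/Λ ≃ Iso(Λ,Γ)/Γ` inverting the representatives which fix `1`. -/
def invEquiv : IsoQuot S T ≃ IsoQuot T S where
  toFun x := mk x.rep.inv
  invFun y := mk y.rep.inv
  left_inv := ind fun f hf => by
    beta_reduce
    rw [rep_mk hf, rep_mk (inv_one_eq hf), inv_inv_eq]
  right_inv := ind fun f hf => by
    beta_reduce
    rw [rep_mk hf, rep_mk (inv_one_eq hf), inv_inv_eq]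

theorem invEquiv_mk {f : CayleyIso S T} (hf : f.toEquiv 1 = 1) :
    invEquiv (mk f) = mk f.inv := by
  simp only [invEquiv, Equiv.coe_fn_mk, rep_mk hf]

theorem invEquiv_symm : (invEquiv (S := S) (T := T)).symm = invEquiv := rfl

theorem measurable_invEquiv [Countable Γ] [Countable Λ] :
    Measurable (invEquiv : IsoQuot S T → IsoQuot T S) :=
  measurable_mk.comp (measurable_inv.comp measurable_rep)

theorem preQ_leftMult_one (x : IsoQuot S T) : preQ (leftMult S 1) x = x := by
  induction x using ind with
  | _ f hf =>
    rw [preQ_mk]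
    congr 1
    ext x
    simp

theorem preQ_leftMult_mul (g h : Γ) (x : IsoQuot S T) :
    preQ (leftMult S (g * h)) x = preQ (leftMult S g) (preQ (leftMult S h) x) := by
  induction x using ind with
  | _ f hf =>
    simp only [preQ_mk]
    congr 1
    ext x
    simp [mul_assoc]

theorem exists_invEquiv_preQ_leftMult (γ : Γ) (x : IsoQuot S T) :
    ∃ lam : Λ, wlen T lam = wlen S γ ∧
      invEquiv (preQ (leftMult S γ) x) = preQ (leftMult T lam) (invEquiv x) := by
  induction x using ind with
  | _ f hf =>
    refine ⟨(f.toEquiv γ⁻¹)⁻¹, ?_, ?_⟩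
    · simpa [hf] using f.isom γ⁻¹ 1
    · have key : mk (comp f (leftMult S γ)⁻¹) =
          mk ((f.toEquiv γ⁻¹)⁻¹ • comp f (leftMult S γ)⁻¹) := (mk_smul _ _).symm
      rw [preQ_mk, key, invEquiv_mk (by simp), invEquiv_mk hf, preQ_mk,
        ← mk_smul γ⁻¹]
      congr 1
      ext x
      change γ⁻¹ * (γ * f.toEquiv.symm (((f.toEquiv γ⁻¹)⁻¹)⁻¹ * x)) =
        f.toEquiv.symm (((f.toEquiv γ⁻¹)⁻¹)⁻¹ * x)
      rw [inv_mul_cancel_left]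

theorem gdist_invEquiv_le (x x' : IsoQuot S T) :
    gdist (fun lam : Λ => preQ (leftMult T lam)) T (invEquiv x) (invEquiv x') ≤
      gdist (fun γ : Γ => preQ (leftMult S γ)) S x x' :=
  gdist_map_le preQ_leftMult_one preQ_leftMult_mul preQ_leftMult_one preQ_leftMult_mul
    exists_invEquiv_preQ_leftMult x x'

theorem gdist_invEquiv (x x' : IsoQuot S T) :
    gdist (fun lam : Λ => preQ (leftMult T lam)) T (invEquiv x) (invEquiv x') =
      gdist (fun γ : Γ => preQ (leftMult S γ)) S x x' := by
  refine (gdist_invEquiv_le x x').antisymm ?_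
  have h := gdist_invEquiv_le (invEquiv x) (invEquiv x')
  rwa [← invEquiv_symm, Equiv.symm_apply_apply, Equiv.symm_apply_apply] at h

/-- The inversion map carries an `Iso(Γ)`-invariant probability measure to any
`Iso(Λ)`-invariant one: both are computed by integrating `f ∘ f₀⁻¹ ∘ f'` in either order. -/
theorem measurePreserving_invEquiv [Countable Γ] [Countable Λ] (f₀ : CayleyIso S T)
    (μ : Measure (IsoQuot S T)) [IsProbabilityMeasure μ]
    (hμ : ∀ g : CayleyIso S S, MeasurePreserving (preQ g) μ μ)
    (ν : Measure (IsoQuot T S)) [IsProbabilityMeasure ν]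
    (hν : ∀ g : CayleyIso T T, MeasurePreserving (preQ g) ν ν) :
    MeasurePreserving (invEquiv : IsoQuot S T → IsoQuot T S) μ ν := by
  wlog hf₀ : f₀.toEquiv 1 = 1 generalizing f₀
  · exact this f₀.normalize f₀.normalize_one
  refine ⟨measurable_invEquiv, Measure.ext fun A hA => ?_⟩
  rw [Measure.map_apply measurable_invEquiv hA]
  let M : IsoQuot S T × IsoQuot T S → IsoQuot T S := fun p =>
    invEquiv (mk (comp p.1.rep (comp f₀.inv p.2.rep.inv)))
  have hM : Measurable M := by
    have hx : Measurable fun p : IsoQuot S T × IsoQuot T S => p.1.rep :=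
      measurable_rep.comp measurable_fst
    have hy : Measurable fun p : IsoQuot S T × IsoQuot T S => p.2.rep.inv :=
      measurable_inv.comp (measurable_rep.comp measurable_snd)
    exact measurable_invEquiv.comp <| measurable_mk.comp <|
      measurable_comp hx (measurable_comp measurable_const hy)
  have h_left (y : IsoQuot T S) :
      μ ((fun x => (x, y)) ⁻¹' (M ⁻¹' A)) = μ (invEquiv ⁻¹' A) := by
    have : (fun x => (x, y)) ⁻¹' (M ⁻¹' A) =
        preQ (comp f₀.inv y.rep.inv : CayleyIso S S)⁻¹ ⁻¹' (invEquiv ⁻¹' A) := by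
      ext x
      induction x using ind with
      | _ f hf => simp [M, preQ_mk, rep_mk hf]
    rw [this, (hμ _).measure_preimage (measurable_invEquiv hA).nullMeasurableSet]
  have h_right (x : IsoQuot S T) : ν (Prod.mk x ⁻¹' (M ⁻¹' A)) = ν A := by
    have : Prod.mk x ⁻¹' (M ⁻¹' A) =
        preQ (comp x.rep f₀.inv : CayleyIso T T) ⁻¹' A := by
      ext y
      induction x using ind with
      | _ f hf =>
        induction y using ind with
        | _ g hg =>
          have h1 : (comp f (comp f₀.inv g.inv)).toEquiv 1 = 1 := by
            have h2 : g.toEquiv.symm 1 = 1 := inv_one_eq hg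
            have h3 : f₀.toEquiv.symm 1 = 1 := inv_one_eq hf₀
            simp [h2, h3, hf]
          simp only [M, Set.mem_preimage, preQ_mk, rep_mk hf, rep_mk hg, invEquiv_mk h1]
          rfl
    rw [this, (hν _).measure_preimage hA.nullMeasurableSet]
  have h1 := Measure.prod_apply (μ := μ) (ν := ν) (hM hA)
  have h2 := Measure.prod_apply_symm (μ := μ) (ν := ν) (hM hA)
  simp only [h_left, h_right, lintegral_const, measure_univ, mul_one] at h1 h2
  exact h2.symm.trans h1

end IsoQuot

end IOE

open MeasureTheory IOE

/-- If the Cayley graphs of `Γ = ⟨S_Γ⟩` and `Λ = ⟨S_Λ⟩` are isometric,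
then the p.m.p. actions `Γ ↷ (Iso(Γ,Λ)/Λ, m_Λ)` and `Λ ↷ (Iso(Λ,Γ)/Γ, m_Γ)` (with their
Haar probability measures) are isometric orbit equivalent. -/
theorem stmt4
    {Γ Λ : Type*} [Group Γ] [Group Λ]
    (SΓ : Set Γ) (SΛ : Set Λ) (hSΓ : IsFinGenSystem SΓ) (hSΛ : IsFinGenSystem SΛ)
    (hiso : Nonempty (CayleyIso SΓ SΛ))
    -- the Haar probability measure on `Iso(Γ,Λ)/Λ` : the unique probability measure
    -- invariant under the (descended) action of `Iso(Γ)` by pre-composition by the inverse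
    (mΛ : Measure (Quotient (MulAction.orbitRel Λ (CayleyIso SΓ SΛ))))
    [IsProbabilityMeasure mΛ]
    (hmΛ : ∀ g : CayleyIso SΓ SΓ, MeasurePreserving (preQ g) mΛ mΛ)
    -- the Haar probability measure on `Iso(Λ,Γ)/Γ`
    (mΓ : Measure (Quotient (MulAction.orbitRel Γ (CayleyIso SΛ SΓ))))
    [IsProbabilityMeasure mΓ]
    (hmΓ : ∀ g : CayleyIso SΛ SΛ, MeasurePreserving (preQ g) mΓ mΓ) :
    IsomOrbitEquiv
      (fun γ : Γ => preQ (CayleyIso.leftMult SΓ γ)) SΓ mΛ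
      (fun lam : Λ => preQ (CayleyIso.leftMult SΛ lam)) SΛ mΓ := by
  have := hSΓ.countable
  have := hSΛ.countable
  obtain ⟨f₀⟩ := hiso
  refine ⟨IsoQuot.invEquiv, IsoQuot.measurable_invEquiv, IsoQuot.measurable_invEquiv,
    IsoQuot.measurePreserving_invEquiv f₀ mΛ hmΛ mΓ hmΓ, Set.univ, by simp,
    fun _ _ _ _ => trivial, ?_, fun x _ x' _ => IsoQuot.gdist_invEquiv x x'⟩
  rw [Set.image_univ, Equiv.range_eq_univ]
  exact fun _ _ _ _ => trivial
end

section
/- Let Γ = ⟨S_Γ⟩ and Λ = ⟨S_Λ⟩ be finitely generated groups whose Cayley graphs (Γ,S_Γ) and (Λ,S_Λ) are isometric, and assume the isometry group Iso(Γ) of the Cayley graph (Γ,S_Γ) is countable. Let Γ ↷^α (X,μ) and Λ ↷^β (Y,ν) be p.m.p. essentially free actions that are isometric orbit equivalent. Then: (i) there exist finite index subgroups Γ₀ ≤ Γ and Λ₀ ≤ Λ that are isomorphic; (ii) there exist a Γ₀-invariant set X₀ ⊆ X of positive measure and a Λ₀-invariant set Y₀ ⊆ Y of positive measure such that the p.m.p.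 actions Γ₀ ↷ (X₀, μ_{X₀}) and Λ₀ ↷ (Y₀, ν_{Y₀}) (with the normalized restricted measures) are measurably isomorphic. If moreover every finite index subgroup of Γ acts ergodically on (X,μ), then Γ and Λ are isomorphic and the actions α and β are measurably isomorphic (via a group isomorphism Γ → Λ intertwining them). -/
open MeasureTheory

namespace IOE

section Gdist

variable {G X : Type*} [Group G] [MeasurableSpace X] {act : G → X → X} {S : Set G}
  {μ : Measure X}

theorem IsPmpAction.foldr_eq (h : IsPmpAction act μ) (l : List G) (x : X) :
    l.foldr act x = act l.prod x := by
  induction l with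
  | nil => simp [h.one_act]
  | cons a l ih => simp [ih, h.mul_act]

theorem exists_act_eq_of_gdist_ne_top (h : IsPmpAction act μ) {x y : X}
    (hxy : gdist act S x y ≠ ⊤) : ∃ g, act g x = y := by
  by_contra hne
  push Not at hne
  refine hxy (sInf_eq_top.2 ?_)
  rintro n ⟨l, -, hl, -⟩
  exact absurd (h.foldr_eq l x ▸ hl) (hne _)

theorem gdist_act_ne_top (h : IsPmpAction act μ) (hS : IsGenSystem S) (g : G) (x : X) :
    gdist act S x (act g x) ≠ ⊤ := by
  have hg : g ∈ Submonoid.closure (S ∪ S⁻¹) := by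
    rw [← Subgroup.closure_toSubmonoid, hS.closure_eq_top]; trivial
  obtain ⟨l, hl, rfl⟩ := Submonoid.exists_list_of_mem_closure hg
  have hlS : ∀ s ∈ l, s ∈ S := fun s hs => (hl s hs).elim id fun h' => by
    simpa using hS.inv_mem _ h'
  refine ne_top_of_le_ne_top (ENat.natCast_ne_top l.length) (sInf_le ⟨l, hlS, ?_, rfl⟩)
  exact h.foldr_eq l x

theorem IsPmpAction.act_left_injective (h : IsPmpAction act μ) {x : X}
    (hx : ∀ g, act g x = x → g = 1) {a b : G} (hab : act a x = act b x) : a = b := by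
  have : act (b⁻¹ * a) x = x := by
    rw [h.mul_act, hab, ← h.mul_act, inv_mul_cancel, h.one_act]
  exact (inv_mul_eq_one.1 (hx _ this)).symm

/-- Along a free orbit, the graph metric is the word metric. -/
theorem gdist_act_act (h : IsPmpAction act μ) {x : X} (hx : ∀ g, act g x = x → g = 1)
    (a b : G) : gdist act S (act a x) (act b x) = wlen S (b * a⁻¹) := by
  unfold gdist wlen
  congr 1
  ext n
  refine exists_congr fun l => and_congr_right fun _ => and_congr_left fun _ => ?_
  rw [h.foldr_eq, ← h.mul_act, eq_mul_inv_iff_mul_eq]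
  exact ⟨h.act_left_injective hx, fun hab => by rw [hab]⟩

/-- A conull set contains a measurable conull invariant set. -/
theorem exists_measurable_invariant_conull [Countable G] (h : IsPmpAction act μ) {A : Set X}
    (hA : A ∈ ae μ) :
    ∃ B ⊆ A, MeasurableSet B ∧ B ∈ ae μ ∧ ∀ g, ∀ x ∈ B, act g x ∈ B := by
  obtain ⟨M, hMA, hMmeas, hM⟩ := exists_measurable_superset_of_null (mem_ae_iff.1 hA)
  refine ⟨⋂ g, act g ⁻¹' Mᶜ, fun x hx => ?_, ?_, ?_, fun g x hx => ?_⟩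
  · have := Set.mem_iInter.1 hx 1
    rw [Set.mem_preimage, h.one_act] at this
    exact not_not.1 fun hxA => this (hMA hxA)
  · exact MeasurableSet.iInter fun g => (h.measurePreserving g).measurable hMmeas.compl
  · refine countable_iInter_mem.2 fun g => ?_
    exact (h.measurePreserving g).quasiMeasurePreserving.tendsto_ae
      (mem_ae_iff.2 (by rwa [compl_compl]))
  · refine Set.mem_iInter.2 fun k => ?_
    rw [Set.mem_preimage, ← h.mul_act]
    exact Set.mem_iInter.1 hx (k * g)

end Gdist

section

variable {Γ Λ : Type*} [Group Γ] [Group Λ] {S : Set Γ} {T : Set Λ}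

theorem countable_of_countable_cayleyIso (S : Set Γ) [Countable (CayleyIso S S)] :
    Countable Γ := by
  refine Function.Injective.countable (f := CayleyIso.leftMult S) fun a b hab => ?_
  simpa using congrArg (fun f : CayleyIso S S => f.toEquiv 1) hab

theorem CayleyIso.countable_of_nonempty [Countable (CayleyIso S S)]
    (h : Nonempty (CayleyIso S T)) : Countable (CayleyIso S T) := by
  obtain ⟨f₀⟩ := h
  refine Function.Injective.countable (f := CayleyIso.comp f₀.inv) fun f g hfg => ?_
  ext x
  exact f₀.toEquiv.symm.injective
    (congrArg (fun k : CayleyIso S S => k.toEquiv x) hfg)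

/-- The elements with respect to which a bijection of groups is left multiplicative. -/
def leftMultiplicative (f : Γ ≃ Λ) (hf : f 1 = 1) : Subgroup Γ where
  carrier := {g | ∀ δ, f (g * δ) = f g * f δ}
  one_mem' δ := by simp [hf]
  mul_mem' {a b} ha hb δ := by
    rw [mul_assoc, ha, hb, ha b, mul_assoc]
  inv_mem' {a} ha := by
    have key : ∀ δ, f (a⁻¹ * δ) = (f a)⁻¹ * f δ := fun δ => by
      rw [eq_inv_mul_iff_mul_eq, ← ha, mul_inv_cancel_left]
    intro δ
    have h1 := key 1
    rw [mul_one, hf, mul_one] at h1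
    rw [key, h1]

theorem mem_leftMultiplicative {f : Γ ≃ Λ} {hf : f 1 = 1} {g : Γ} :
    g ∈ leftMultiplicative f hf ↔ ∀ δ, f (g * δ) = f g * f δ := Iff.rfl

/-- The restriction of a bijection of groups to the subgroup on which it is multiplicative. -/
def leftMultiplicativeHom (f : Γ ≃ Λ) (hf : f 1 = 1) : leftMultiplicative f hf →* Λ where
  toFun g := f g
  map_one' := hf
  map_mul' a b := a.2 b

theorem leftMultiplicativeHom_injective (f : Γ ≃ Λ) (hf : f 1 = 1) :
    Function.Injective (leftMultiplicativeHom f hf) :=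
  fun _ _ h => Subtype.ext (f.injective h)

theorem map_inv_of_mem_leftMultiplicative {f : Γ ≃ Λ} {hf : f 1 = 1} {g : Γ}
    (hg : g ∈ leftMultiplicative f hf) : f g⁻¹ = (f g)⁻¹ :=
  map_inv (leftMultiplicativeHom f hf) ⟨g, hg⟩

theorem finiteIndex_range_leftMultiplicativeHom (f : Γ ≃ Λ) (hf : f 1 = 1)
    [(leftMultiplicative f hf).FiniteIndex] :
    (leftMultiplicativeHom f hf).range.FiniteIndex := by
  have hsurj : Function.Surjective fun q : Γ ⧸ leftMultiplicative f hf =>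
      (QuotientGroup.mk (f q.out⁻¹)⁻¹ : Λ ⧸ (leftMultiplicativeHom f hf).range) := by
    intro q
    obtain ⟨l, rfl⟩ := QuotientGroup.mk_surjective q
    obtain ⟨γ, hγ⟩ := f.surjective l⁻¹
    refine ⟨(γ⁻¹ : Γ), ?_⟩
    obtain ⟨n, hn⟩ := QuotientGroup.mk_out_eq_mul (leftMultiplicative f hf) γ⁻¹
    refine QuotientGroup.eq.2 ⟨n⁻¹, ?_⟩
    have hn' : f ((n : Γ)⁻¹ * γ) = f (n : Γ)⁻¹ * f γ := inv_mem n.2 γ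
    rw [hn, mul_inv_rev, inv_inv, inv_inv, hn', hγ]
    simp [leftMultiplicativeHom]
  have := Finite.of_surjective _ hsurj
  exact Subgroup.finiteIndex_of_finite_quotient

end

section FiberSet

variable {Γ Λ X Y : Type*} [Group Γ] [Group Λ] {α : Γ → X → X} {β : Λ → Y → Y}

/-- The points `x` of `B` at which the orbit map `Φ` is described by `f`, that is
`Φ (γ⁻¹ x) = f(γ)⁻¹ Φ(x)` for all `γ`. -/
def fiberSet (α : Γ → X → X) (β : Λ → Y → Y) (Φ : X → Y) (B : Set X) (f : Γ → Λ) : Set X :=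
  {x ∈ B | ∀ γ, Φ (α γ⁻¹ x) = β (f γ)⁻¹ (Φ x)}

variable {Φ : X → Y} {B : Set X}

theorem map_act_of_mem_fiberSet {f : Γ ≃ Λ} {hf : f 1 = 1} {g : Γ}
    (hg : g ∈ leftMultiplicative f hf) {x : X} (hx : x ∈ fiberSet α β Φ B f) :
    Φ (α g x) = β (f g) (Φ x) := by
  have := hx.2 g⁻¹
  rwa [inv_inv, map_inv_of_mem_leftMultiplicative hg, inv_inv] at this

variable [MeasurableSpace X] [MeasurableSpace Y] {μ : Measure X} {ν : Measure Y}

theorem measurableSet_fiberSet [Countable Γ] [StandardBorelSpace Y] (hα : IsPmpAction α μ)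
    (hβ : IsPmpAction β ν) (hΦ : Measurable Φ) (hB : MeasurableSet B) (f : Γ → Λ) :
    MeasurableSet (fiberSet α β Φ B f) := by
  have : fiberSet α β Φ B f = B ∩ ⋂ γ, {x | Φ (α γ⁻¹ x) = β (f γ)⁻¹ (Φ x)} := by
    ext x; simp [fiberSet]
  rw [this]
  refine hB.inter (MeasurableSet.iInter fun γ => measurableSet_eq_fun ?_ ?_)
  · exact hΦ.comp (hα.measurePreserving _).measurable
  · exact (hβ.measurePreserving _).measurable.comp hΦ

theorem act_mem_fiberSet (hα : IsPmpAction α μ) (hβ : IsPmpAction β ν)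
    (hBinv : ∀ g, ∀ x ∈ B, α g x ∈ B) {f : Γ ≃ Λ} {hf : f 1 = 1} {g : Γ}
    (hg : g ∈ leftMultiplicative f hf) {x : X} (hx : x ∈ fiberSet α β Φ B f) :
    α g x ∈ fiberSet α β Φ B f := by
  refine ⟨hBinv g x hx.1, fun γ => ?_⟩
  have h1 := hx.2 (g⁻¹ * γ)
  rw [mul_inv_rev, inv_inv, hα.mul_act, inv_mem hg, mul_inv_rev, hβ.mul_act,
    map_inv_of_mem_leftMultiplicative hg, inv_inv] at h1
  rw [h1, map_act_of_mem_fiberSet hg hx]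

theorem preimage_act_fiberSet (hα : IsPmpAction α μ) (hβ : IsPmpAction β ν)
    (hBinv : ∀ g, ∀ x ∈ B, α g x ∈ B) {f : Γ ≃ Λ} {hf : f 1 = 1} {g : Γ}
    (hg : g ∈ leftMultiplicative f hf) :
    α g ⁻¹' fiberSet α β Φ B f = fiberSet α β Φ B f := by
  refine Set.Subset.antisymm (fun x hx => ?_)
    fun x hx => act_mem_fiberSet hα hβ hBinv hg hx
  have := act_mem_fiberSet hα hβ hBinv (inv_mem hg) hx
  rwa [← hα.mul_act, inv_mul_cancel, hα.one_act] at this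

/-- Return times to a fiber set belong to the subgroup on which `f` is multiplicative. -/
theorem mem_leftMultiplicative_of_return (hα : IsPmpAction α μ) (hβ : IsPmpAction β ν)
    (hBfree : ∀ x ∈ B, ∀ h, β h (Φ x) = Φ x → h = 1) {f : Γ ≃ Λ} {hf : f 1 = 1} {k : Γ}
    {x : X} (hx : x ∈ fiberSet α β Φ B f) (hkx : α k x ∈ fiberSet α β Φ B f) :
    k ∈ leftMultiplicative f hf := by
  rw [← inv_mem_iff]
  intro γ
  have h1 := hx.2 (k⁻¹ * γ)
  have h2 := hx.2 k⁻¹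
  rw [mul_inv_rev, inv_inv, hα.mul_act, hkx.2 γ, ← inv_inv k, h2, ← hβ.mul_act,
    inv_inv] at h1
  have := hβ.act_left_injective (hBfree x hx.1) h1
  rw [← mul_inv_rev, inv_inj] at this
  exact this.symm

theorem finiteIndex_leftMultiplicative [IsFiniteMeasure μ]
    (hα : IsPmpAction α μ) (hβ : IsPmpAction β ν)
    (hBfree : ∀ x ∈ B, ∀ h, β h (Φ x) = Φ x → h = 1) {f : Γ ≃ Λ} (hf : f 1 = 1)
    (hmeas : MeasurableSet (fiberSet α β Φ B f)) (hpos : 0 < μ (fiberSet α β Φ B f)) :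
    (leftMultiplicative f hf).FiniteIndex := by
  set A := fiberSet α β Φ B f
  set H := leftMultiplicative f hf
  let E : Γ ⧸ H → Set X := fun q => α q.out⁻¹ ⁻¹' A
  have hE : ∀ q, MeasurableSet (E q) := fun q => (hα.measurePreserving _).measurable hmeas
  have hμE : ∀ q, μ (E q) = μ A := fun q =>
    (hα.measurePreserving _).measure_preimage hmeas.nullMeasurableSet
  have hdisj : Pairwise (Function.onFun Disjoint E) := by
    intro p q hpq
    refine Set.disjoint_left.2 fun x hxp hxq => hpq ?_
    have hk : α (p.out⁻¹ * q.out) (α q.out⁻¹ x) ∈ A := by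
      rwa [← hα.mul_act, mul_assoc, mul_inv_cancel, mul_one]
    have := mem_leftMultiplicative_of_return hα hβ hBfree (hf := hf) hxq hk
    rw [← QuotientGroup.out_eq' p, ← QuotientGroup.out_eq' q]
    exact QuotientGroup.eq.2 this
  have hfin := Measure.finite_const_le_meas_of_disjoint_iUnion μ hpos hE hdisj
    (measure_ne_top _ _)
  have huniv : {q | μ A ≤ μ (E q)} = Set.univ := by
    ext q; simp [hμE]
  rw [huniv, Set.finite_univ_iff] at hfin
  exact Subgroup.finiteIndex_of_finite_quotient

/-- At almost every point, an isometric orbit equivalence is described by an isometry of the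
Cayley graphs. -/
theorem exists_cayleyIso_mem_fiberSet {SΓ : Set Γ} {SΛ : Set Λ} (hSΓ : IsGenSystem SΓ)
    (hSΛ : IsGenSystem SΛ) (hα : IsPmpAction α μ) (hβ : IsPmpAction β ν) {Φ : X ≃ Y}
    {X₀ : Set X} (hX₀ : Saturated α SΓ X₀) (hY₀ : Saturated β SΛ (Φ '' X₀))
    (hisom : ∀ x ∈ X₀, ∀ x' ∈ X₀, gdist β SΛ (Φ x) (Φ x') = gdist α SΓ x x')
    {x : X} (hxB : x ∈ B) (hx : x ∈ X₀) (hxα : ∀ g, α g x = x → g = 1)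
    (hxβ : ∀ h, β h (Φ x) = Φ x → h = 1) :
    ∃ f : CayleyIso SΓ SΛ, x ∈ fiberSet α β Φ B f.toEquiv := by
  have hmem : ∀ g, α g x ∈ X₀ := fun g => hX₀ x hx _ (gdist_act_ne_top hα hSΓ g x)
  have hex : ∀ γ : Γ, ∃ l : Λ, Φ (α γ⁻¹ x) = β l⁻¹ (Φ x) := by
    intro γ
    obtain ⟨l, hl⟩ := exists_act_eq_of_gdist_ne_top hβ (S := SΛ) (x := Φ x)
      (y := Φ (α γ⁻¹ x)) (by
        rw [hisom x hx _ (hmem _)]; exact gdist_act_ne_top hα hSΓ _ x)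
    exact ⟨l⁻¹, by rw [inv_inv, hl]⟩
  choose f hf using hex
  have hinj : Function.Injective f := by
    intro a b hab
    have : Φ (α a⁻¹ x) = Φ (α b⁻¹ x) := by rw [hf, hf, hab]
    exact inv_injective (hα.act_left_injective hxα (Φ.injective this))
  have hsurj : Function.Surjective f := by
    intro l
    obtain ⟨x', hx', hx'l⟩ := hY₀ (Φ x) ⟨x, hx, rfl⟩ _ (gdist_act_ne_top hβ hSΛ l⁻¹ (Φ x))
    obtain ⟨g, rfl⟩ := exists_act_eq_of_gdist_ne_top hα (S := SΓ) (x := x) (y := x') (by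
      rw [← hisom x hx _ hx', hx'l]; exact gdist_act_ne_top hβ hSΛ _ _)
    refine ⟨g⁻¹, inv_injective (hβ.act_left_injective hxβ ?_)⟩
    rw [← hf, inv_inv, hx'l]
  refine ⟨⟨Equiv.ofBijective f ⟨hinj, hsurj⟩, fun a b => ?_⟩, hxB, hf⟩
  have h := hisom _ (hmem b⁻¹) _ (hmem a⁻¹)
  rw [hf, hf, gdist_act_act hβ hxβ, gdist_act_act hα hxα] at h
  rw [inv_inv, inv_inv] at h
  exact h

end FiberSet

/-- The restriction of a measure preserving bijection to a measurable set preserves the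
normalized restricted measures. -/
theorem measurePreserving_image {X Y : Type*} [MeasurableSpace X] [MeasurableSpace Y]
    {μ : Measure X} {ν : Measure Y} (Φ : X ≃ Y) (hΦ : MeasurePreserving Φ μ ν)
    (hΦ' : Measurable Φ.symm) {A : Set X} (hA : MeasurableSet A) :
    MeasurePreserving (Φ.image A)
      ((μ A)⁻¹ • μ.comap (Subtype.val : A → X))
      ((ν (Φ '' A))⁻¹ • ν.comap (Subtype.val : (Φ '' A : Set Y) → Y)) := by
  have hA' : MeasurableSet (Φ '' A) := by
    rw [Equiv.image_eq_preimage_symm]; exact hΦ' hA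
  have hm : Measurable (Φ.image A) :=
    (hΦ.measurable.comp measurable_subtype_coe).subtype_mk
  have hν : ν (Φ '' A) = μ A := by
    rw [← hΦ.measure_preimage hA'.nullMeasurableSet, Φ.preimage_image]
  refine ⟨hm, ?_⟩
  ext s hs
  rw [Measure.map_apply hm hs, Measure.smul_apply, Measure.smul_apply, hν,
    (MeasurableEmbedding.subtype_coe hA).comap_apply,
    (MeasurableEmbedding.subtype_coe hA').comap_apply,
    ← hΦ.measure_preimage (hA'.subtype_image hs).nullMeasurableSet]
  congr 2
  ext x
  simp [Equiv.image]

end IOE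

open MeasureTheory IOE

/-- Rigidity of isometric orbit equivalence when the isometry group of
the Cayley graph is countable: the groups are virtually isomorphic, the actions are
virtually measurably isomorphic, and under ergodicity of all finite index subgroups the
groups are isomorphic and the actions measurably isomorphic. -/
theorem stmt6
    {Γ Λ X Y : Type*} [Group Γ] [Group Λ]
    [MeasurableSpace X] [StandardBorelSpace X] [MeasurableSpace Y] [StandardBorelSpace Y]
    (SΓ : Set Γ) (SΛ : Set Λ) (hSΓ : IsFinGenSystem SΓ) (hSΛ : IsFinGenSystem SΛ)
    (hiso : Nonempty (CayleyIso SΓ SΛ))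
    (hcount : Countable (CayleyIso SΓ SΓ))
    (μ : Measure X) (ν : Measure Y) [IsProbabilityMeasure μ] [IsProbabilityMeasure ν]
    (α : Γ → X → X) (β : Λ → Y → Y)
    (hα : IsPmpAction α μ) (hβ : IsPmpAction β ν)
    (hαfree : EssentiallyFree α μ) (hβfree : EssentiallyFree β ν)
    (hOE : IsomOrbitEquiv α SΓ μ β SΛ ν) :
    -- (i) and (ii): virtual isomorphism of the groups and of the actions
    (∃ (Γ₀ : Subgroup Γ) (Λ₀ : Subgroup Λ), Γ₀.FiniteIndex ∧ Λ₀.FiniteIndex ∧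
      ∃ (iso : ↥Γ₀ ≃* ↥Λ₀) (X₀ : Set X) (Y₀ : Set Y),
        MeasurableSet X₀ ∧ MeasurableSet Y₀ ∧ 0 < μ X₀ ∧ 0 < ν Y₀ ∧
        ∃ (hX₀ : ∀ g ∈ Γ₀, ∀ x ∈ X₀, α g x ∈ X₀) (_ : ∀ h ∈ Λ₀, ∀ y ∈ Y₀, β h y ∈ Y₀)
          (Ψ : ↥X₀ ≃ ↥Y₀),
          Measurable Ψ ∧ Measurable Ψ.symm ∧
          MeasurePreserving Ψ
            ((μ X₀)⁻¹ • μ.comap (Subtype.val : ↥X₀ → X))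
            ((ν Y₀)⁻¹ • ν.comap (Subtype.val : ↥Y₀ → Y)) ∧
          ∀ g : ↥Γ₀, ∀ᵐ (x : ↥X₀) ∂((μ X₀)⁻¹ • μ.comap (Subtype.val : ↥X₀ → X)),
            (Ψ ⟨α (g : Γ) (x : X), hX₀ (g : Γ) g.2 (x : X) x.2⟩ : Y)
              = β ((iso g : ↥Λ₀) : Λ) ((Ψ x : Y))) ∧
    -- moreover: full rigidity under ergodicity of all finite index subgroups
    ((∀ Γ' : Subgroup Γ, Γ'.FiniteIndex →
        ∀ A : Set X, MeasurableSet A → (∀ g ∈ Γ', α g ⁻¹' A = A) → μ A = 0 ∨ μ Aᶜ = 0) →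
      ∃ (iso : Γ ≃* Λ) (Ψ : X ≃ Y),
        Measurable Ψ ∧ Measurable Ψ.symm ∧ MeasurePreserving Ψ μ ν ∧
        ∀ γ : Γ, ∀ᵐ x ∂μ, Ψ (α γ x) = β (iso γ) (Ψ x)) := by
  have : Countable Γ := countable_of_countable_cayleyIso SΓ
  have : Countable (CayleyIso SΓ SΛ) := CayleyIso.countable_of_nonempty hiso
  obtain ⟨Φ, hΦ, hΦ', hΦμ, X₀, hX₀, hX₀s, hY₀s, hisom⟩ := hOE
  have hconull : {x | x ∈ X₀ ∧ (∀ g, α g x = x → g = 1) ∧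
      ∀ h, β h (Φ x) = Φ x → h = 1} ∈ ae μ := by
    filter_upwards [mem_ae_iff.2 hX₀, hαfree, hΦμ.quasiMeasurePreserving.ae hβfree]
      with x h1 h2 h3 using ⟨h1, h2, h3⟩
  obtain ⟨B, hBsub, hBmeas, hB, hBinv⟩ := exists_measurable_invariant_conull hα hconull
  have hBfree : ∀ x ∈ B, ∀ h, β h (Φ x) = Φ x → h = 1 := fun x hx => (hBsub hx).2.2
  have hcover : B ⊆ ⋃ f : CayleyIso SΓ SΛ, fiberSet α β Φ B f.toEquiv := fun x hx =>
    Set.mem_iUnion.2 (exists_cayleyIso_mem_fiberSet hSΓ.toIsGenSystem hSΛ.toIsGenSystem hα hβ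
      hX₀s hY₀s hisom hx (hBsub hx).1 (hBsub hx).2.1 (hBsub hx).2.2)
  have hpos : μ (⋃ f : CayleyIso SΓ SΛ, fiberSet α β Φ B f.toEquiv) ≠ 0 := by
    intro h0
    obtain ⟨x, hx, hx'⟩ := Filter.nonempty_of_mem (Filter.inter_mem hB (compl_mem_ae_iff.2 h0))
    exact hx' (hcover hx)
  obtain ⟨F, hF⟩ := exists_measure_pos_of_not_measure_iUnion_null hpos
  set f := F.toEquiv
  obtain ⟨x₀, hx₀⟩ := nonempty_of_measure_ne_zero hF.ne'
  have hf : f 1 = 1 := by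
    have h := hx₀.2 1
    rw [inv_one, hα.one_act] at h
    exact inv_eq_one.1 (hBfree x₀ hx₀.1 _ h.symm)
  have hAmeas := measurableSet_fiberSet hα hβ hΦ hBmeas f
  have hfi := finiteIndex_leftMultiplicative hα hβ hBfree hf hAmeas hF
  refine ⟨⟨leftMultiplicative f hf, (leftMultiplicativeHom f hf).range, hfi,
    finiteIndex_range_leftMultiplicativeHom f hf,
    MonoidHom.ofInjective (leftMultiplicativeHom_injective f hf),
    fiberSet α β Φ B f, Φ '' fiberSet α β Φ B f, hAmeas, ?_, hF, ?_,
    fun g hg x hx => act_mem_fiberSet hα hβ hBinv hg hx, ?_,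
    Φ.image _, (hΦ.comp measurable_subtype_coe).subtype_mk,
    (hΦ'.comp measurable_subtype_coe).subtype_mk,
    measurePreserving_image Φ hΦμ hΦ' hAmeas, fun g => ae_of_all _ fun x => ?_⟩, ?_⟩
  · rw [Equiv.image_eq_preimage_symm]; exact hΦ' hAmeas
  · refine hF.trans_le ?_
    rw [← hΦμ.map_eq]
    exact (measure_mono (Set.subset_preimage_image _ _)).trans
      (Measure.le_map_apply hΦ.aemeasurable _)
  · rintro _ ⟨g, rfl⟩ _ ⟨x, hx, rfl⟩
    exact ⟨α g x, act_mem_fiberSet hα hβ hBinv g.2 hx, map_act_of_mem_fiberSet g.2 hx⟩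
  · exact map_act_of_mem_fiberSet g.2 x.2
  · intro herg
    have hA : fiberSet α β Φ B f ∈ ae μ := mem_ae_iff.2 <|
      (herg _ hfi _ hAmeas fun g hg => preimage_act_fiberSet hα hβ hBinv hg).resolve_left hF.ne'
    have htop : ∀ k, k ∈ leftMultiplicative f hf := by
      intro k
      obtain ⟨x, hx, hkx⟩ := Filter.nonempty_of_mem (Filter.inter_mem hA
        ((hα.measurePreserving k).quasiMeasurePreserving.tendsto_ae hA))
      exact mem_leftMultiplicative_of_return hα hβ hBfree hx hkx
    refine ⟨⟨f, fun a b => htop a b⟩, Φ, hΦ, hΦ', hΦμ, fun γ => ?_⟩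
    filter_upwards [hA] with x hx
    exact map_act_of_mem_fiberSet (htop γ) hx
end
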